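/- If the Borel probability measure α on Ω is C*-Gibbs for a Hölder potential U, then the push-forward measure τ_*α (the probability measure determined by ∫ g d(τ_*α) = ∫ g ∘ τ dα for all continuous g) is also C*-Gibbs for U. -/

import Mathlib

open MeasureTheory Filter
open scoped ENNReal

noncomputable section

/-- The two-sided full shift space `Ω = {1,…,d}^ℤ` (alphabet `Fin d`). -/
abbrev Omega (d : ℕ) : Type := ℤ → Fin d

/-- The shift map `τ`, `(τ x) j = x (j+1)`. -/
def tau (d : ℕ) (x : Omega d) : Omega d := fun j => x (j + 1)

/-- The `k`-th iterate of the shift (`k ∈ ℤ`): `(τ^k x) j = x (j + k)`. -/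
def tauZ (d : ℕ) (k : ℤ) (x : Omega d) : Omega d := fun j => x (j + k)

/-- `x` and `y` are homoclinic: they differ in only finitely many coordinates. -/
def Homoclinic (d : ℕ) (x y : Omega d) : Prop := Set.Finite {j : ℤ | x j ≠ y j}

/-- `U` is Hölder continuous for the standard metric `dist x y = 2^{-N}`:
there are `C > 0` and `0 < θ < 1` with `|U x - U y| ≤ C θ^N` whenever
`x` and `y` agree on all coordinates `|j| ≤ N`. -/
def HolderPotential (d : ℕ) (U : Omega d → ℝ) : Prop :=
  ∃ C θ : ℝ, 0 < C ∧ 0 < θ ∧ θ < 1 ∧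
    ∀ (x y : Omega d) (N : ℕ), (∀ j : ℤ, |j| ≤ (N : ℤ) → x j = y j) →
      |U x - U y| ≤ C * θ ^ N

/-- `U` depends on only finitely many coordinates. -/
def FiniteRange (d : ℕ) (U : Omega d → ℝ) : Prop :=
  ∃ s : Finset ℤ, ∀ x y : Omega d, (∀ j ∈ s, x j = y j) → U x = U y

/-- `V(x,y) = ∑_{k ∈ ℤ} (U(τ^k x) - U(τ^k y))`. -/
def Vfun (d : ℕ) (U : Omega d → ℝ) (x y : Omega d) : ℝ :=
  ∑' k : ℤ, (U (tauZ d k x) - U (tauZ d k y))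

/-- The cylinder `{z : z_j = a_j for -n ≤ j ≤ m}`. -/
def cyl (d : ℕ) (n m : ℕ) (a : ℤ → Fin d) : Set (Omega d) :=
  {z | ∀ j : ℤ, -(n : ℤ) ≤ j → j ≤ (m : ℤ) → z j = a j}

/-- The conjugating homeomorphism with window `-n ≤ j ≤ m` and target word `b`:
it replaces the coordinates in the window by those of `b` and keeps the rest. -/
def conjMap (d : ℕ) (n m : ℕ) (b : ℤ → Fin d) (z : Omega d) : Omega d :=
  fun j => if -(n : ℤ) ≤ j ∧ j ≤ (m : ℤ) then b j else z j

/-- `α` is a C*-Gibbs measure for `U` (at inverse temperature `β = 1`):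
for every symmetric conjugating homeomorphism `(O, φ)` and every continuous
`f : Ω → ℂ`, `∫_O e^{-V(z, φ z)} f(φ z) dα = ∫_{φ(O)} f dα`. -/
def CStarGibbs (d : ℕ) (U : Omega d → ℝ) (α : Measure (Omega d)) : Prop :=
  ∀ n : ℕ, 1 ≤ n → ∀ (a b : ℤ → Fin d) (f : Omega d → ℂ), Continuous f →
    ∫ z in cyl d n n a,
        (Real.exp (-(Vfun d U z (conjMap d n n b z))) : ℂ) * f (conjMap d n n b z) ∂α
      = ∫ z in cyl d n n b, f z ∂α

/-- `α` is a quasi-C*-Gibbs measure for `U`: there are constants `d₁, d₂ > 0`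
such that for every conjugating homeomorphism `(O, φ)` and every nonnegative
continuous `f : Ω → ℝ`,
`d₁ ∫_O e^{-V(z,φz)} f(φ z) dα ≤ ∫_{φ(O)} f dα ≤ d₂ ∫_O e^{-V(z,φz)} f(φ z) dα`. -/
def QuasiCStarGibbs (d : ℕ) (U : Omega d → ℝ) (α : Measure (Omega d)) : Prop :=
  ∃ d₁ d₂ : ℝ, 0 < d₁ ∧ 0 < d₂ ∧
    ∀ (n m : ℕ), 1 ≤ n → 1 ≤ m → ∀ (a b : ℤ → Fin d) (f : Omega d → ℝ),
      Continuous f → (∀ z, 0 ≤ f z) →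
      (d₁ * ∫ z in cyl d n m a,
          Real.exp (-(Vfun d U z (conjMap d n m b z))) * f (conjMap d n m b z) ∂α
        ≤ ∫ z in cyl d n m b, f z ∂α) ∧
      (∫ z in cyl d n m b, f z ∂α
        ≤ d₂ * ∫ z in cyl d n m a,
            Real.exp (-(Vfun d U z (conjMap d n m b z))) * f (conjMap d n m b z) ∂α)

/-- The future cylinder `{z : z_k = a_k for 1 ≤ k ≤ s}`. -/
def futureCyl (d : ℕ) (s : ℕ) (a : ℕ → Fin d) : Set (Omega d) :=
  {z | ∀ k : ℕ, 1 ≤ k → k ≤ s → z (k : ℤ) = a k}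

/-- The Birkhoff sum `∑_{k=0}^{s-1} U(τ^k x)`. -/
def birkhoff (d : ℕ) (U : Omega d → ℝ) (s : ℕ) (x : Omega d) : ℝ :=
  ∑ k ∈ Finset.range s, U (tauZ d (k : ℤ) x)

/-- `ρ` is the equilibrium (Gibbs) probability for `U`: it is `τ`-invariant and
satisfies Bowen's inequalities. -/
def IsEquilibrium (d : ℕ) (U : Omega d → ℝ) (ρ : Measure (Omega d)) : Prop :=
  Measure.map (tau d) ρ = ρ ∧
  ∃ C₁ C₂ P : ℝ, 0 < C₁ ∧ 0 < C₂ ∧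
    ∀ s : ℕ, 1 ≤ s → ∀ (a : ℕ → Fin d) (x : Omega d),
      (∀ k : ℕ, 1 ≤ k → k ≤ s → x (k : ℤ) = a k) →
      C₁ ≤ (ρ (futureCyl d s a)).toReal * Real.exp (P * s - birkhoff d U s x) ∧
      (ρ (futureCyl d s a)).toReal * Real.exp (P * s - birkhoff d U s x) ≤ C₂

/-- The point whose coordinates `1, 2, 3, …` are `j, x₁, x₂, …`. -/
def prepend (d : ℕ) (j : Fin d) (x : Omega d) : Omega d :=
  fun k => if k = 1 then j else x (k - 1)

/-- A potential depending on the coordinates `x₁, …, x_r` is normalized if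
`∑_{j=1}^d exp(f(j, x₁, …, x_{r-1})) = 1` for all choices of `x₁, …, x_{r-1}`. -/
def Normalized (d : ℕ) (U : Omega d → ℝ) : Prop :=
  ∀ x : Omega d, ∑ j : Fin d, Real.exp (U (prepend d j x)) = 1

lemma measurable_tau (d : ℕ) : Measurable (tau d) :=
  measurable_pi_lambda _ fun j => measurable_pi_apply (j + 1)

lemma continuous_tau (d : ℕ) : Continuous (tau d) :=
  continuous_pi fun j => continuous_apply (j + 1)

lemma continuous_tauZ (d : ℕ) (k : ℤ) : Continuous (tauZ d k) :=
  continuous_pi fun j => continuous_apply (j + k)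

lemma continuous_conjMap (d n m : ℕ) (b : ℤ → Fin d) : Continuous (conjMap d n m b) := by
  refine continuous_pi fun j => ?_
  unfold conjMap
  split_ifs
  · exact continuous_const
  · exact continuous_apply j

lemma measurableSet_cyl (d n m : ℕ) (a : ℤ → Fin d) : MeasurableSet (cyl d n m a) := by
  have h : cyl d n m a = ⋂ (j : ℤ) (_ : -(n : ℤ) ≤ j) (_ : j ≤ (m : ℤ)), {z | z j = a j} := by
    ext z
    simp [cyl]
  rw [h]
  exact MeasurableSet.iInter fun j => MeasurableSet.iInter fun _ => MeasurableSet.iInter fun _ =>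
    (measurable_pi_apply (X := fun _ : ℤ => Fin d) j) (measurableSet_singleton (a j))

/-- The sum defining `V` is invariant under the simultaneous shift of both points. -/
lemma Vfun_tau (d : ℕ) (U : Omega d → ℝ) (x y : Omega d) :
    Vfun d U (tau d x) (tau d y) = Vfun d U x y := by
  have h : ∀ (k : ℤ) (z : Omega d), tauZ d k (tau d z) = tauZ d (k + 1) z := by
    intro k z
    funext j
    simp only [tauZ, tau]
    congr 1
    ring
  simp only [Vfun, h]
  exact (Equiv.addRight (1 : ℤ)).tsum_eq fun k => U (tauZ d k x) - U (tauZ d k y)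

/-- A Hölder potential is continuous. -/
lemma HolderPotential.continuous {d : ℕ} {U : Omega d → ℝ} (hU : HolderPotential d U) :
    Continuous U := by
  obtain ⟨C, θ, hC, hθ, hθ1, h⟩ := hU
  rw [continuous_iff_continuousAt]
  intro x
  rw [ContinuousAt, Metric.tendsto_nhds]
  intro ε hε
  have hlim : Tendsto (fun N : ℕ => C * θ ^ N) atTop (nhds 0) := by
    simpa using (tendsto_pow_atTop_nhds_zero_of_lt_one hθ.le hθ1).const_mul C
  obtain ⟨N, hN⟩ := (hlim.eventually_lt_const hε).exists
  have hev : ∀ᶠ y in nhds x, ∀ j ∈ Finset.Icc (-(N : ℤ)) N, y j = x j := by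
    rw [Filter.eventually_all_finset]
    intro j _
    have hopen : IsOpen ((fun y : Omega d => y j) ⁻¹' {x j}) :=
      (isOpen_discrete _).preimage (continuous_apply j)
    exact hopen.mem_nhds rfl
  filter_upwards [hev] with y hy
  rw [Real.dist_eq]
  exact (h y x N fun j hj => hy j (Finset.mem_Icc.2 (abs_le.1 hj))).trans_lt hN

lemma summable_geometric_natAbs_sub {θ : ℝ} (h0 : 0 ≤ θ) (h1 : θ < 1) (K : ℝ) (n : ℕ) :
    Summable fun k : ℤ => K * θ ^ (k.natAbs - n) := by
  have h : Summable fun k : ℕ => K * θ ^ (k - n) := by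
    rw [← summable_nat_add_iff n]
    simpa using (summable_geometric_of_lt_one h0 h1).mul_left K
  exact Summable.of_nat_of_neg (by simpa using h) (by simpa using h)

/-- The cocycle `z ↦ V(z, φ z)` of a conjugating homeomorphism is continuous. -/
lemma continuous_Vfun_conjMap {d : ℕ} {U : Omega d → ℝ} (hU : HolderPotential d U)
    (n : ℕ) (b : ℤ → Fin d) : Continuous fun z => Vfun d U z (conjMap d n n b z) := by
  have hc := hU.continuous
  obtain ⟨C, θ, hC, hθ, hθ1, h⟩ := hU
  obtain ⟨M, hM⟩ := isCompact_univ.exists_bound_of_continuousOn hc.continuousOn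
  refine continuous_tsum (fun k => ?_)
    (summable_geometric_natAbs_sub hθ.le hθ1 (max C (2 * M)) (n + 1)) fun k z => ?_
  · exact (hc.comp (continuous_tauZ d k)).sub
      (hc.comp ((continuous_tauZ d k).comp (continuous_conjMap d n n b)))
  · rw [Real.norm_eq_abs]
    by_cases hk : n + 1 ≤ k.natAbs
    · refine (h _ _ (k.natAbs - (n + 1)) fun j hj => ?_).trans
        (mul_le_mul_of_nonneg_right (le_max_left _ _) (by positivity))
      have hj' : ¬ (-(n : ℤ) ≤ j + k ∧ j + k ≤ (n : ℤ)) := by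
        rw [abs_le] at hj
        omega
      simp only [tauZ, conjMap, if_neg hj']
    · rw [Nat.sub_eq_zero_of_le (by omega), pow_zero, mul_one]
      refine le_trans ?_ (le_max_right _ _)
      have h1 := abs_le.1 (hM (tauZ d k z) trivial)
      have h2 := abs_le.1 (hM (tauZ d k (conjMap d n n b z)) trivial)
      rw [abs_le]
      constructor <;> linarith [h1.1, h1.2, h2.1, h2.2]

/-- The word `a` moved one step to the right, with the letters `c.1, c.2` at the positions
`-(n+1), -n`. -/
def shiftWord (d n : ℕ) (c : Fin d × Fin d) (a : ℤ → Fin d) : ℤ → Fin d :=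
  fun i => if i = -((n : ℤ) + 1) then c.1 else if i = -(n : ℤ) then c.2 else a (i - 1)

lemma mem_cyl_shiftWord {d n : ℕ} {c : Fin d × Fin d} {a : ℤ → Fin d} {z : Omega d} :
    z ∈ cyl d (n + 1) (n + 1) (shiftWord d n c a) ↔
      z (-((n : ℤ) + 1)) = c.1 ∧ z (-(n : ℤ)) = c.2 ∧ tau d z ∈ cyl d n n a := by
  simp only [cyl, Set.mem_ofPred_eq, tau, shiftWord, Nat.cast_add, Nat.cast_one]
  constructor
  · intro h
    refine ⟨?_, ?_, fun j h1 h2 => ?_⟩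
    · simpa using h (-((n : ℤ) + 1)) (by omega) (by omega)
    · simpa using h (-(n : ℤ)) (by omega) (by omega)
    · have := h (j + 1) (by omega) (by omega)
      rwa [if_neg (by omega), if_neg (by omega), add_sub_cancel_right] at this
  · rintro ⟨h1, h2, h3⟩ j hj1 hj2
    split_ifs with e1 e2
    · rw [e1, h1]
    · rw [e2, h2]
    · simpa using h3 (j - 1) (by omega) (by omega)

lemma preimage_tau_cyl (d n : ℕ) (a : ℤ → Fin d) :
    tau d ⁻¹' cyl d n n a =
      ⋃ c : Fin d × Fin d, cyl d (n + 1) (n + 1) (shiftWord d n c a) := by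
  ext z
  simp only [Set.mem_preimage, Set.mem_iUnion, mem_cyl_shiftWord]
  exact ⟨fun h => ⟨(_, _), rfl, rfl, h⟩, fun ⟨_, _, _, h⟩ => h⟩

lemma pairwise_disjoint_cyl_shiftWord (d n : ℕ) (a : ℤ → Fin d) :
    Pairwise (Function.onFun Disjoint fun c : Fin d × Fin d =>
      cyl d (n + 1) (n + 1) (shiftWord d n c a)) := by
  intro c c' hne
  refine Set.disjoint_left.2 fun z hz hz' => hne ?_
  rw [mem_cyl_shiftWord] at hz hz'
  exact Prod.ext (hz.1.symm.trans hz'.1) (hz.2.1.symm.trans hz'.2.1)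

lemma conjMap_tau {d n : ℕ} {c : Fin d × Fin d} {a b : ℤ → Fin d} {z : Omega d}
    (hz : z ∈ cyl d (n + 1) (n + 1) (shiftWord d n c a)) :
    conjMap d n n b (tau d z) =
      tau d (conjMap d (n + 1) (n + 1) (shiftWord d n c b) z) := by
  obtain ⟨h1, h2, -⟩ := mem_cyl_shiftWord.1 hz
  funext j
  simp only [conjMap, tau, shiftWord, Nat.cast_add, Nat.cast_one]
  split_ifs with e1 e2 e3 e4 e5 e6 e7 <;> first | omega | skip
  · rw [add_sub_cancel_right]
  all_goals simp_all

/-- Integrals of continuous functions over a cylinder against `τ_* α` split into integrals over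
larger cylinders against `α`. -/
lemma setIntegral_map_tau_cyl {d : ℕ} (n : ℕ) (a : ℤ → Fin d) (α : Measure (Omega d))
    [IsFiniteMeasure α] {g : Omega d → ℂ} (hg : Continuous g) :
    ∫ z in cyl d n n a, g z ∂(Measure.map (tau d) α) =
      ∑ c : Fin d × Fin d,
        ∫ z in cyl d (n + 1) (n + 1) (shiftWord d n c a), g (tau d z) ∂α := by
  rw [setIntegral_map (measurableSet_cyl d n n a) hg.aestronglyMeasurable
    (measurable_tau d).aemeasurable, preimage_tau_cyl]
  refine integral_iUnion_fintype (fun c => measurableSet_cyl _ _ _ _)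
    (pairwise_disjoint_cyl_shiftWord d n a) fun c => ?_
  exact ((hg.comp (continuous_tau d)).integrable_of_hasCompactSupport
    (HasCompactSupport.of_compactSpace _)).integrableOn

/-- the push-forward under `τ` of a C*-Gibbs measure for `U` is
again C*-Gibbs for `U`. -/
theorem pushforward_cstarGibbs (d : ℕ) (hd : 2 ≤ d) (U : Omega d → ℝ)
    (hU : HolderPotential d U) (α : Measure (Omega d)) (hα : IsProbabilityMeasure α)
    (hGibbs : CStarGibbs d U α) :
    CStarGibbs d U (Measure.map (tau d) α) := by
  intro n hn a b f hf
  have hcont : Continuous fun z : Omega d =>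
      (Real.exp (-(Vfun d U z (conjMap d n n b z))) : ℂ) * f (conjMap d n n b z) :=
    (Complex.continuous_ofReal.comp
      (Real.continuous_exp.comp (continuous_Vfun_conjMap hU n b).neg)).mul
      (hf.comp (continuous_conjMap d n n b))
  rw [setIntegral_map_tau_cyl n a α hcont, setIntegral_map_tau_cyl n b α hf]
  refine Finset.sum_congr rfl fun c _ => ?_
  rw [← hGibbs (n + 1) (by omega) (shiftWord d n c a) (shiftWord d n c b)
    (fun z => f (tau d z)) (hf.comp (continuous_tau d))]
  refine setIntegral_congr_fun (measurableSet_cyl _ _ _ _) fun z hz => ?_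
  simp only [conjMap_tau hz, Vfun_tau]
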